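/- There is no Dodd-sound ultrafilter on ℕ. That is, there is no nonprincipal ultrafilter U on ℕ for which there exists a sequence ⟨𝒜_n : n ∈ ℕ⟩, where each 𝒜_n is a family of subsets of the interval [0,n) = {0,…,n−1}, such that for every sequence ⟨X_n : n ∈ ℕ⟩ with X_n ⊆ [0,n), the following are equivalent: (1) there exists X ⊆ ℕ with {n : X ∩ [0,n) = X_n} ∈ U; (2) {n : X_n ∈ 𝒜_n} ∈ U. -/

import Mathlib

/-- There is no Dodd-sound (nonprincipal) ultrafilter on `ℕ`: there is no nonprincipal
ultrafilter `U` together with a sequence `⟨𝒜 n⟩` of families of subsets of `[0, n)` such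
that a sequence `⟨X n⟩` (with `X n ⊆ [0, n)`) is `U`-threadable iff `{n | X n ∈ 𝒜 n} ∈ U`. -/
theorem stmt4 :
    ¬ ∃ (U : Ultrafilter ℕ), (∀ A ∈ U, A.Infinite) ∧
      ∃ 𝒜 : ℕ → Set (Set ℕ),
        (∀ n, ∀ A ∈ 𝒜 n, A ⊆ Set.Iio n) ∧
        ∀ X : ℕ → Set ℕ, (∀ n, X n ⊆ Set.Iio n) →
          ((∃ Y : Set ℕ, {n | Y ∩ Set.Iio n = X n} ∈ U) ↔ {n | X n ∈ 𝒜 n} ∈ U) := by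
  rintro ⟨U, hU, 𝒜, hsub, h⟩
  -- `P n k`: some two members of `𝒜 n` first differ at `k`
  let P : ℕ → ℕ → Set ℕ → Set ℕ → Prop := fun n k A B =>
    A ∈ 𝒜 n ∧ B ∈ 𝒜 n ∧ k ∈ A ∧ k ∉ B ∧ ∀ i < k, (i ∈ A ↔ i ∈ B)
  have hgt : ∀ k, {n | k < n} ∈ U := by
    intro k
    by_contra hk
    have h1 := Ultrafilter.compl_mem_iff_notMem.mpr hk
    refine hU _ h1 ((Set.finite_Iic k).subset ?_)
    intro n hn
    simpa using hn
  have hY : ∀ Y : Set ℕ, {n | Y ∩ Set.Iio n ∈ 𝒜 n} ∈ U := by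
    intro Y
    refine (h (fun n => Y ∩ Set.Iio n) (fun n => Set.inter_subset_right)).1 ⟨Y, ?_⟩
    simp only [Set.setOf_true]
    exact Filter.univ_mem
  have hP : ∀ k, {n | ∃ A B, P n k A B} ∈ U := by
    intro k
    filter_upwards [hY {k}, hY ∅, hgt k] with n h1 h2 h3
    refine ⟨_, _, h1, h2, ⟨rfl, h3⟩, by simp, ?_⟩
    intro i hi
    have : i ≠ k := hi.ne
    simp [this]
  have hmax : ∀ n, ∃ (A B : Set ℕ) (k : ℕ), A ⊆ Set.Iio n ∧ B ⊆ Set.Iio n ∧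
      ((∃ k A B, P n k A B) → P n k A B ∧ ∀ l, (∃ A B, P n l A B) → l ≤ k) := by
    intro n
    by_cases hn : ∃ k A B, P n k A B
    · have hfin : {k | ∃ A B, P n k A B}.Finite := by
        refine (Set.finite_Iio n).subset ?_
        rintro k ⟨A, B, hA, -, hk, -⟩
        exact hsub n A hA hk
      obtain ⟨k, ⟨A, B, hk⟩, hm⟩ := Set.exists_max_image _ id hfin hn
      exact ⟨A, B, k, hsub n A hk.1, hsub n B hk.2.1, fun _ => ⟨hk, hm⟩⟩
    · exact ⟨∅, ∅, 0, Set.empty_subset _, Set.empty_subset _, fun h' => absurd h' hn⟩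
  choose A B k hA hB hk using hmax
  have hAU : {n | A n ∈ 𝒜 n} ∈ U := by
    filter_upwards [hP 0] with n hn
    exact (hk n ⟨0, hn⟩).1.1
  have hBU : {n | B n ∈ 𝒜 n} ∈ U := by
    filter_upwards [hP 0] with n hn
    exact (hk n ⟨0, hn⟩).1.2.1
  obtain ⟨Y, hYA⟩ := (h A hA).2 hAU
  obtain ⟨Z, hZB⟩ := (h B hB).2 hBU
  obtain ⟨m, ⟨⟨hm1, hm2⟩, hm3⟩⟩ :=
    (hU _ (Filter.inter_mem (Filter.inter_mem hYA hZB) (hP 0))).nonempty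
  obtain ⟨⟨-, -, hkA, hkB, -⟩, -⟩ := hk m ⟨0, hm3⟩
  have hlt : k m < m := hA m hkA
  have hkY : k m ∈ Y := by
    rw [← show Y ∩ Set.Iio m = A m from hm1] at hkA
    exact hkA.1
  have hkZ : k m ∉ Z := by
    intro hz
    rw [← show Z ∩ Set.Iio m = B m from hm2] at hkB
    exact hkB ⟨hz, hlt⟩
  obtain ⟨n, ⟨⟨⟨hn1, hn2⟩, hn3⟩, hn4⟩⟩ :=
    (hU _ (Filter.inter_mem (Filter.inter_mem (Filter.inter_mem hYA hZB) (hP (k m + 1)))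
      (hgt (k m)))).nonempty
  obtain ⟨⟨-, -, -, -, hag⟩, hle⟩ := hk n ⟨_, hn3⟩
  have h5 := hag (k m) (hle _ hn3)
  rw [← show Y ∩ Set.Iio n = A n from hn1, ← show Z ∩ Set.Iio n = B n from hn2] at h5
  exact hkZ (h5.1 ⟨hkY, hn4⟩).1
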